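/- arXiv:2005.01076 — 9 statements merged into one kernel-verified Lean document; each statement's English description precedes it below -/
import Mathlib

section
/- Let z be a complex number and let t be a natural number such that 2^{−t} ≤ | |z| − 1 | and |z| ≤ 2^t. Then for every natural number n, every positive integer k, and every complex number ẑ with |z − ẑ| ≤ 2^{−(n + (t+1)(k+1))}, one has |1/(z^k − 1) − 1/(ẑ^k − 1)| ≤ 2^{−n}. -/
theorem aux_pow_sub (z w : ℂ) (M d : ℝ) (hz : ‖z‖ ≤ M) (hw : ‖w‖ ≤ M) (hd : ‖z - w‖ ≤ d) (m : ℕ) :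
    ‖z ^ (m+1) - w ^ (m+1)‖ ≤ (m+1) * M ^ m * d := by
  have hM : 0 ≤ M := (norm_nonneg z).trans hz
  have hd0 : 0 ≤ d := (norm_nonneg _).trans hd
  induction m with
  | zero => simpa using hd
  | succ m ih =>
    have e : z ^ (m+1+1) - w ^ (m+1+1) = z * (z^(m+1) - w^(m+1)) + (z - w) * w^(m+1) := by ring
    rw [e]
    calc _ ≤ ‖z * (z^(m+1) - w^(m+1))‖ + ‖(z - w) * w^(m+1)‖ := norm_add_le _ _
      _ = ‖z‖ * ‖z^(m+1) - w^(m+1)‖ + ‖z - w‖ * ‖w‖^(m+1) := by simp only [norm_mul, norm_pow]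
      _ ≤ M * ((m+1) * M ^ m * d) + d * M^(m+1) := by gcongr
      _ = _ := by push_cast; ring

theorem aux_num (m : ℕ) : ((m:ℝ)+1) * (5/4)^m ≤ 2^(m+1) := by
  induction m with
  | zero => norm_num
  | succ m ih =>
    rcases Nat.eq_zero_or_pos m with rfl | hm
    · norm_num
    · have h : (1:ℝ) ≤ m := by exact_mod_cast hm
      have hp : (0:ℝ) < (5/4)^m := by positivity
      rw [pow_succ, pow_succ (2:ℝ)]
      push_cast
      nlinarith

theorem aux_low (z : ℂ) (m : ℕ) : |‖z‖ - 1| ≤ ‖z^(m+1) - 1‖ := by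
  have h := abs_norm_sub_norm_le (z^(m+1)) 1
  rw [norm_pow, norm_one] at h
  refine le_trans ?_ h
  have h0 := norm_nonneg z
  generalize ‖z‖ = a at *
  rcases le_total a 1 with h1 | h1
  · have : a^(m+1) ≤ a := by
      rw [pow_succ]; exact mul_le_of_le_one_left h0 (pow_le_one₀ h0 h1)
    rw [abs_of_nonpos (by linarith), abs_of_nonpos (by linarith)]; linarith
  · have : a ≤ a^(m+1) := by
      rw [pow_succ]; exact le_mul_of_one_le_left h0 (one_le_pow₀ h1)
    rw [abs_of_nonneg (by linarith), abs_of_nonneg (by linarith)]; linarith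

/-- Lemma 4.3 (Item 3) with `r(n,k) = n + (t+1)(k+1)`: if `2^{-t} ≤ ||z|-1|` and
`|z| ≤ 2^t`, then whenever `|z - ẑ| ≤ 2^{-(n+(t+1)(k+1))}` we have
`|1/(z^k-1) - 1/(ẑ^k-1)| ≤ 2^{-n}`. -/
theorem stmt_2 (z : ℂ) (t : ℕ)
    (h1 : (2 : ℝ) ^ (-(t : ℤ)) ≤ |‖z‖ - 1|)
    (h2 : ‖z‖ ≤ 2 ^ t) :
    ∀ (n : ℕ) (k : ℕ), 0 < k → ∀ zhat : ℂ,
      ‖z - zhat‖ ≤ (2 : ℝ) ^ (-((n + (t + 1) * (k + 1) : ℕ) : ℤ)) →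
      ‖1 / (z ^ k - 1) - 1 / (zhat ^ k - 1)‖ ≤ (2 : ℝ) ^ (-(n : ℤ)) := by
  intro n k hk w hw
  obtain ⟨m, rfl⟩ : ∃ m, k = m + 1 := ⟨k - 1, by omega⟩
  rw [zpow_neg, zpow_natCast] at h1 hw ⊢
  have hP1 : (1:ℝ) ≤ 2^t := one_le_pow₀ (by norm_num)
  have hD : (2:ℝ)^(n + (t+1)*(m+1+1)) = 2^n * ((2^t)^(m+2) * 2^(m+2)) := by
    rw [← pow_mul, ← pow_add, ← pow_add]; congr 1; ring
  rw [hD] at hw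
  generalize (2:ℝ)^t = P at *
  have hN1 : (1:ℝ) ≤ 2^n := one_le_pow₀ (by norm_num)
  generalize (2:ℝ)^n = N at *
  have hP0 : 0 < P := by linarith
  have hN0 : 0 < N := by linarith
  set d : ℝ := (N * (P^(m+2) * 2^(m+2)))⁻¹ with hd
  have hd0 : 0 < d := by positivity
  have h4 : 4 * P ≤ N * (P^(m+2) * 2^(m+2)) := by
    have a1 : P ≤ P^(m+2) := le_self_pow₀ hP1 (by omega)
    have a2 : (4:ℝ) ≤ 2^(m+2) := by
      have : (1:ℝ) ≤ 2^m := one_le_pow₀ (by norm_num)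
      rw [pow_add]; linarith
    calc 4 * P = 1 * (P * 4) := by ring
      _ ≤ _ := by gcongr
  have hd1 : d ≤ P⁻¹ / 4 := by
    calc d ≤ (4 * P)⁻¹ := by rw [hd]; gcongr
      _ = _ := by rw [mul_inv]; ring
  have hPi : P⁻¹ ≤ 1 := inv_le_one_of_one_le₀ hP1
  have hPi0 : 0 < P⁻¹ := by positivity
  have hab : |‖z‖ - ‖w‖| ≤ d := (abs_norm_sub_norm_le z w).trans hw
  have hwM : ‖w‖ ≤ 5/4 * P := by have := abs_le.1 hab; linarith
  have hzM : ‖z‖ ≤ 5/4 * P := by linarith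
  have hb : P⁻¹ / 2 ≤ |‖w‖ - 1| := by
    have := abs_sub_le ‖z‖ ‖w‖ 1
    linarith
  have hZ := h1.trans (aux_low z m)
  have hW := hb.trans (aux_low w m)
  have hz0 : z^(m+1) - 1 ≠ 0 := norm_pos_iff.1 (by linarith)
  have hw0 : w^(m+1) - 1 ≠ 0 := norm_pos_iff.1 (by linarith)
  have hdiff := aux_pow_sub z w _ d hzM hwM hw m
  have hnum : ((m:ℝ)+1) * (5/4*P)^m * d ≤ 2^(m+1) * P^m * d := by
    rw [mul_pow, ← mul_assoc]
    gcongr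
    exact aux_num m
  rw [div_sub_div _ _ hz0 hw0, norm_div, norm_mul]
  have e : 1 * (w ^ (m+1) - 1) - (z^(m+1) - 1) * 1 = -(z^(m+1) - w^(m+1)) := by ring
  rw [e, norm_neg]
  calc _ ≤ (2^(m+1) * P^m * d) / (P⁻¹ * (P⁻¹/2)) := by
        gcongr
        exact hdiff.trans hnum
    _ = N⁻¹ := by
        rw [hd]; field_simp; ring
end

section
/- Let a and b be rational numbers with 0 ≤ a < b ≤ 1. Let z be a complex number with |z| = 1 that is not a root of unity (i.e. z^j ≠ 1 for every positive integer j). Then there exists a positive integer k such that for every positive integer n there exists an integer m with n ≤ m ≤ n + k − 1 and such that z^m = exp(iθ) for some real θ ∈ [2πa, 2πb]. -/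
theorem aux_eq (s t : ℝ) : ((s : AddCircle (2 * Real.pi)) = t) ↔
    Complex.exp (s * Complex.I) = Complex.exp (t * Complex.I) := by
  have h1 : ((s : AddCircle (2 * Real.pi)) = t) ↔ ∃ k : ℤ, s - t = 2 * Real.pi * k :=
    Real.Angle.angle_eq_iff_two_pi_dvd_sub
  rw [h1, Complex.exp_eq_exp_iff_exists_int]
  refine exists_congr fun k => ?_
  constructor
  · intro h
    have : (s : ℂ) = t + 2 * Real.pi * k := by
      have h' : s = t + 2 * Real.pi * k := by linarith
      exact_mod_cast h'
    rw [this]; ring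
  · intro h
    have : (s : ℂ) = t + 2 * Real.pi * k := by
      apply mul_right_cancel₀ Complex.I_ne_zero
      rw [h]; ring
    have h' : s = t + 2 * Real.pi * k := by exact_mod_cast this
    linarith

/-- Lemma 4.8 (computability removed): if `|z| = 1` and `z` is not a root of
unity, then for rationals `0 ≤ a < b ≤ 1` there is a gap `k` such that every
window of `k` consecutive exponents contains an `m` with `z^m = exp(iθ)` for
some `θ ∈ [2πa, 2πb]`. -/
theorem stmt_4 (a b : ℚ) (ha : 0 ≤ a) (hab : a < b) (hb : b ≤ 1)
    (z : ℂ) (hz : ‖z‖ = 1) (hroot : ∀ j : ℕ, 0 < j → z ^ j ≠ 1) :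
    ∃ k : ℕ, 0 < k ∧ ∀ n : ℕ, 0 < n →
      ∃ m : ℕ, n ≤ m ∧ m ≤ n + k - 1 ∧
        ∃ θ : ℝ, 2 * Real.pi * a ≤ θ ∧ θ ≤ 2 * Real.pi * b ∧
          z ^ m = Complex.exp (θ * Complex.I) := by
  have : Fact (0 < 2 * Real.pi) := ⟨Real.two_pi_pos⟩
  have hpow : ∀ m : ℕ, z ^ m = Complex.exp (((m * z.arg : ℝ) : ℂ) * Complex.I) := by
    intro m
    have h := Complex.norm_mul_exp_arg_mul_I z
    rw [hz] at h
    simp only [Complex.ofReal_one, one_mul] at h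
    conv_lhs => rw [← h]
    rw [← Complex.exp_nat_mul]
    push_cast
    congr 1
    ring
  obtain ⟨x, hx⟩ : ∃ x : AddCircle (2 * Real.pi), x = (z.arg : ℝ) := ⟨_, rfl⟩
  have hnx : ∀ m : ℕ, m • x = ((m * z.arg : ℝ) : AddCircle (2 * Real.pi)) := by
    intro m
    rw [hx, ← AddCircle.coe_nsmul, nsmul_eq_mul]
  have hfin : ¬ IsOfFinAddOrder x := by
    rw [isOfFinAddOrder_iff_nsmul_eq_zero]
    rintro ⟨j, hj, h⟩
    apply hroot j hj
    rw [hnx, ← AddCircle.coe_zero, aux_eq] at h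
    rw [hpow, h]
    simp
  have hd : DenseRange (fun n : ℕ => n • x) := by
    rw [← denseRange_zsmul_iff_nsmul]
    rw [← addOrderOf_eq_zero_iff] at hfin
    exact AddCircle.denseRange_zsmul_iff.2 hfin
  have hab' : 2 * Real.pi * (a : ℝ) < 2 * Real.pi * b :=
    mul_lt_mul_of_pos_left (by exact_mod_cast hab) Real.two_pi_pos
  let U : Set (AddCircle (2 * Real.pi)) :=
    (fun t : ℝ => (t : AddCircle (2 * Real.pi))) '' Set.Ioo (2 * Real.pi * a) (2 * Real.pi * b)
  have hU : IsOpen U := QuotientAddGroup.isOpenMap_coe _ isOpen_Ioo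
  have hUn : U.Nonempty := (Set.nonempty_Ioo.2 hab').image _
  obtain ⟨F, hF⟩ := isCompact_univ.elim_finite_subcover
    (fun n : ℕ => {y : AddCircle (2 * Real.pi) | y + n • x ∈ U})
    (fun n => hU.preimage (by fun_prop))
    (by
      intro y _
      obtain ⟨u, hu⟩ := hUn
      obtain ⟨n, hn⟩ := hd.exists_mem_open (s := {w | y + w ∈ U})
        (hU.preimage (by fun_prop)) ⟨-y + u, by simpa using hu⟩
      exact Set.mem_iUnion.2 ⟨n, hn⟩)
  refine ⟨F.sup id + 1, Nat.succ_pos _, fun n _ => ?_⟩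
  have hy := hF (Set.mem_univ (n • x))
  simp only [Set.mem_iUnion, Set.mem_setOf_eq] at hy
  obtain ⟨j, hj, t, ht, hte⟩ := hy
  have hle : j ≤ F.sup id := Finset.le_sup (f := id) hj
  refine ⟨n + j, by omega, by omega, t, ht.1.le, ht.2.le, ?_⟩
  rw [hpow, ← aux_eq, ← hnx, add_smul]
  exact hte.symm
end

section
/- Let z be a complex number which is a root of unity of order k, i.e. z^k = 1 and z^j ≠ 1 for all integers j with 1 ≤ j < k, where k ∉ {1, 2, 4}. Then there exists an integer l with π < 2πl/k < 3π/2 such that for every positive integer n there exists an integer m with n ≤ m ≤ n + k − 1 and z^m = exp(2πil/k). -/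
/-- Lemma 4.9 (computability removed): if `z` is a root of unity of order
`k ∉ {1,2,4}`, there is an integer `l` with `π < 2πl/k < 3π/2` such that every
window of `k` consecutive exponents contains an `m` with `z^m = e^{2πil/k}`. -/
theorem stmt_5 (z : ℂ) (k : ℕ) (hk : 0 < k) (hzk : z ^ k = 1)
    (hmin : ∀ j : ℕ, 1 ≤ j → j < k → z ^ j ≠ 1)
    (hk1 : k ≠ 1) (hk2 : k ≠ 2) (hk4 : k ≠ 4) :
    ∃ l : ℤ, Real.pi < 2 * Real.pi * l / k ∧
      2 * Real.pi * l / k < 3 * Real.pi / 2 ∧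
      ∀ n : ℕ, 0 < n → ∃ m : ℕ, n ≤ m ∧ m ≤ n + k - 1 ∧
        z ^ m = Complex.exp (2 * (Real.pi : ℂ) * Complex.I * l / k) := by
  have hp : IsPrimitiveRoot z k := by
    rw [IsPrimitiveRoot.iff hk]
    exact ⟨hzk, fun j h1 h2 => hmin j h1 h2⟩
  have hkR : (0 : ℝ) < k := by exact_mod_cast hk
  have hkC : (k : ℂ) ≠ 0 := by exact_mod_cast hk.ne'
  have hpi := Real.pi_pos
  obtain ⟨l, hl1, hl2⟩ : ∃ l : ℤ, (k : ℤ) < 2 * l ∧ 4 * l < 3 * (k : ℤ) :=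
    ⟨(k : ℤ) / 2 + 1, by omega, by omega⟩
  have hl1' : (k : ℝ) < 2 * l := by exact_mod_cast hl1
  have hl2' : 4 * (l : ℝ) < 3 * k := by exact_mod_cast hl2
  refine ⟨l, ?_, ?_, ?_⟩
  · rw [lt_div_iff₀ hkR]
    nlinarith
  · rw [div_lt_iff₀ hkR]
    nlinarith
  · intro n hn
    have hw : Complex.exp (2 * (Real.pi : ℂ) * Complex.I * l / k) ^ k = 1 := by
      rw [← Complex.exp_nat_mul, Complex.exp_eq_one_iff]
      exact ⟨l, by field_simp⟩
    haveI : NeZero k := ⟨hk.ne'⟩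
    obtain ⟨j, hj, hjw⟩ := hp.eq_pow_of_pow_eq_one hw
    have hlt := Nat.mod_lt (j + (k - 1) * n) hk
    refine ⟨n + (j + (k - 1) * n) % k, by omega, by omega, ?_⟩
    rw [← hjw, pow_add, ← pow_eq_pow_mod _ hzk, ← pow_add]
    have : n + (j + (k - 1) * n) = k * n + j := by
      obtain ⟨k', rfl⟩ : ∃ k', k = k' + 1 := ⟨k - 1, by omega⟩
      simp only [Nat.add_sub_cancel]
      ring
    rw [this, pow_add, pow_mul, hzk, one_pow, one_mul]
end

section
/- Let z be a complex number with Re(z) ≠ 0 and Im(z) ≠ 0, and let θ = Arg(z) be an argument of z. Then there exist a positive integer k and a rational number C > 0 such that for every positive integer n there exists an integer m with n ≤ m ≤ n + k − 1, cos(mθ) ≤ −C, and sin(mθ) ≤ −C. -/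
lemma aux_pt (x a d : ℝ) (M : ℤ) (ha : a < Real.pi / 4) (hd : |d| ≤ a)
    (hx : x = 5 * Real.pi / 4 + d + M * (2 * Real.pi)) :
    Real.cos x ≤ -Real.cos (Real.pi / 4 + a) ∧ Real.sin x ≤ -Real.cos (Real.pi / 4 + a) := by
  have hpi := Real.pi_pos
  obtain ⟨h1, h2⟩ := abs_le.mp hd
  subst hx
  rw [Real.cos_add_int_mul_two_pi, Real.sin_add_int_mul_two_pi]
  have e : 5 * Real.pi / 4 + d = (Real.pi / 4 + d) + Real.pi := by ring
  rw [e, Real.cos_add_pi, Real.sin_add_pi]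
  have e2 : Real.sin (Real.pi / 4 + d) = Real.cos (Real.pi / 4 - d) := by
    rw [← Real.cos_pi_div_two_sub]; congr 1; ring
  rw [e2]
  constructor
  · exact neg_le_neg (Real.cos_le_cos_of_nonneg_of_le_pi (by linarith) (by linarith) (by linarith))
  · exact neg_le_neg (Real.cos_le_cos_of_nonneg_of_le_pi (by linarith) (by linarith) (by linarith))

lemma aux_C (a : ℝ) (h0 : 0 ≤ a) (ha : a < Real.pi / 4) :
    ∃ C : ℚ, 0 < C ∧ (C : ℝ) < Real.cos (Real.pi / 4 + a) := by
  have hpi := Real.pi_pos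
  have h : 0 < Real.cos (Real.pi / 4 + a) :=
    Real.cos_pos_of_mem_Ioo ⟨by linarith, by linarith⟩
  obtain ⟨C, h1, h2⟩ := exists_rat_btwn h
  exact ⟨C, by exact_mod_cast h1, h2⟩

lemma aux_M (y e : ℝ) (he : e ≠ 0) :
    ∃ M : ℤ, 0 ≤ (M * (2 * Real.pi) - y) / e ∧ (M * (2 * Real.pi) - y) / e ≤ 2 * Real.pi / |e| := by
  have hpi := Real.two_pi_pos
  rcases lt_or_gt_of_ne he with h | h
  · refine ⟨⌊y / (2 * Real.pi)⌋, ?_, ?_⟩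
    · apply div_nonneg_of_nonpos _ h.le
      have := Int.floor_le (y / (2 * Real.pi))
      rw [le_div_iff₀ hpi] at this
      linarith
    · have := Int.lt_floor_add_one (y / (2 * Real.pi))
      rw [div_lt_iff₀ hpi] at this
      rw [abs_of_neg h, ← neg_div_neg_eq]
      apply div_le_div_of_nonneg_right _ (by linarith)
      linarith
  · refine ⟨⌈y / (2 * Real.pi)⌉, ?_, ?_⟩
    · apply div_nonneg _ h.le
      have := Int.le_ceil (y / (2 * Real.pi))
      rw [div_le_iff₀ hpi] at this
      linarith
    · have := Int.ceil_lt_add_one (y / (2 * Real.pi))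
      rw [← sub_lt_iff_lt_add, lt_div_iff₀ hpi] at this
      rw [abs_of_pos h]
      apply div_le_div_of_nonneg_right _ (by linarith)
      linarith

lemma aux_step (θ : ℝ) (j : ℕ) (l : ℤ) (e : ℝ) (hj : j * θ = e + l * (2 * Real.pi))
    (he : e ≠ 0) (he2 : |e| < Real.pi / 2) :
    ∃ k : ℕ, 0 < k ∧ ∃ C : ℚ, 0 < C ∧
      ∀ n : ℕ, 0 < n → ∃ m : ℕ, n ≤ m ∧ m ≤ n + k - 1 ∧
        Real.cos (m * θ) ≤ -(C : ℝ) ∧ Real.sin (m * θ) ≤ -(C : ℝ) := by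
  have ha : |e| / 2 < Real.pi / 4 := by linarith
  obtain ⟨C, hC, hC2⟩ := aux_C (|e| / 2) (by positivity) ha
  refine ⟨⌈2 * Real.pi / |e|⌉₊ * j + 1, by omega, C, hC, fun n _ => ?_⟩
  obtain ⟨M, h1, h2⟩ := aux_M (n * θ - 5 * Real.pi / 4) e he
  set u := (M * (2 * Real.pi) - (n * θ - 5 * Real.pi / 4)) / e with hu
  have hue : u * e = M * (2 * Real.pi) - (n * θ - 5 * Real.pi / 4) := by
    rw [hu]; field_simp
  have ht0 : 0 ≤ round u := by
    rw [round_eq]; apply Int.floor_nonneg.mpr; linarith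
  obtain ⟨t, ht⟩ := Int.eq_ofNat_of_zero_le ht0
  have hr := abs_sub_round u
  rw [ht] at hr
  have hK : t ≤ ⌈2 * Real.pi / |e|⌉₊ := by
    have h3 := Nat.le_ceil (2 * Real.pi / |e|)
    have h4 := (abs_le.mp hr).1
    push_cast at h4
    have : (t : ℝ) < (⌈2 * Real.pi / |e|⌉₊ : ℝ) + 1 := by linarith
    have h5 : t < ⌈2 * Real.pi / |e|⌉₊ + 1 := by exact_mod_cast this
    omega
  have hm := Nat.mul_le_mul_right j hK
  refine ⟨n + t * j, by omega, by omega, ?_⟩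
  have hd : |-(u - t) * e| ≤ |e| / 2 := by
    rw [abs_mul, abs_neg]
    have : |u - (t : ℝ)| ≤ 1 / 2 := by simpa using hr
    nlinarith [abs_nonneg e]
  have := aux_pt ((n + t * j : ℕ) * θ) (|e| / 2) (-(u - t) * e) (M + t * l) ha hd (by
    push_cast
    linear_combination (t : ℝ) * hj + hue)
  exact ⟨by linarith [this.1], by linarith [this.2]⟩

lemma aux_three (θ : ℝ) (r : ℕ) (s : ℤ) (hr : r < 3) (l : ℤ) (h3 : 3 * θ = l * (2 * Real.pi))
    (h : r * θ = 4 * Real.pi / 3 + s * (2 * Real.pi)) :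
    ∃ k : ℕ, 0 < k ∧ ∃ C : ℚ, 0 < C ∧
      ∀ n : ℕ, 0 < n → ∃ m : ℕ, n ≤ m ∧ m ≤ n + k - 1 ∧
        Real.cos (m * θ) ≤ -(C : ℝ) ∧ Real.sin (m * θ) ≤ -(C : ℝ) := by
  have hpi := Real.pi_pos
  obtain ⟨C, hC, hC2⟩ := aux_C (Real.pi / 12) (by positivity) (by linarith)
  refine ⟨6, by omega, C, hC, fun n _ => ?_⟩
  refine ⟨3 * (n / 3 + 1) + r, by omega, by omega, ?_⟩
  have := aux_pt ((3 * (n / 3 + 1) + r : ℕ) * θ) (Real.pi / 12) (Real.pi / 12)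
    ((n / 3 + 1 : ℕ) * l + s) (by linarith) (by rw [abs_of_pos (by positivity)]) (by
      generalize n / 3 + 1 = q
      push_cast
      linear_combination (q : ℝ) * h3 + h)
  exact ⟨by linarith [this.1], by linarith [this.2]⟩

/-- Corollary 4.10 (computability removed): if `z` has nonzero real and
imaginary parts and `θ = Arg z`, then there are `k` and a rational `C > 0`
such that every window of `k` consecutive exponents contains an `m` with
`cos(mθ) ≤ -C` and `sin(mθ) ≤ -C`. -/
theorem stmt_6 (z : ℂ) (hre : z.re ≠ 0) (him : z.im ≠ 0) :
    ∃ k : ℕ, 0 < k ∧ ∃ C : ℚ, 0 < C ∧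
      ∀ n : ℕ, 0 < n → ∃ m : ℕ, n ≤ m ∧ m ≤ n + k - 1 ∧
        Real.cos (m * Complex.arg z) ≤ -(C : ℝ) ∧
        Real.sin (m * Complex.arg z) ≤ -(C : ℝ) := by
  have hpi := Real.pi_pos
  have hc : Real.cos z.arg ≠ 0 := fun h => hre (by rw [← Complex.norm_mul_cos_arg, h, mul_zero])
  have hs : Real.sin z.arg ≠ 0 := fun h => him (by rw [← Complex.norm_mul_sin_arg, h, mul_zero])
  have hlo := Complex.neg_pi_lt_arg z
  have hhi := Complex.arg_le_pi z
  generalize z.arg = θ at *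
  have n0 : θ ≠ 0 := by rintro rfl; simp at hs
  have n1 : θ ≠ Real.pi := by rintro rfl; simp at hs
  have n2 : θ ≠ Real.pi / 2 := by rintro rfl; simp at hc
  have n3 : θ ≠ -(Real.pi / 2) := by rintro rfl; simp at hc
  have hhi := lt_of_le_of_ne hhi n1
  by_cases c1 : |θ| < Real.pi / 2
  · exact aux_step θ 1 0 θ (by simp) n0 c1
  by_cases p : 0 < θ
  · rw [abs_of_pos p, not_lt] at c1
    have c1 := lt_of_le_of_ne c1 n2.symm
    by_cases c2 : 3 * Real.pi / 4 < θ
    · exact aux_step θ 2 1 (2 * θ - 2 * Real.pi) (by push_cast; ring)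
        (by intro h; apply n1; linarith) (abs_lt.mpr ⟨by linarith, by linarith⟩)
    by_cases c3 : θ = 2 * Real.pi / 3
    · exact aux_three θ 2 0 (by norm_num) 1 (by rw [c3]; push_cast; ring)
        (by rw [c3]; push_cast; ring)
    · exact aux_step θ 3 1 (3 * θ - 2 * Real.pi) (by push_cast; ring)
        (by intro h; apply c3; linarith) (abs_lt.mpr ⟨by linarith, by linarith⟩)
  · have p : θ < 0 := lt_of_le_of_ne (not_lt.mp p) n0
    rw [abs_of_neg p, not_lt] at c1
    have c1 : θ < -(Real.pi / 2) := lt_of_le_of_ne (by linarith) n3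
    by_cases c2 : θ < -(3 * Real.pi / 4)
    · exact aux_step θ 2 (-1) (2 * θ + 2 * Real.pi) (by push_cast; ring)
        (by intro h; linarith) (abs_lt.mpr ⟨by linarith, by linarith⟩)
    by_cases c3 : θ = -(2 * Real.pi / 3)
    · exact aux_three θ 1 (-1) (by norm_num) (-1) (by rw [c3]; push_cast; ring)
        (by rw [c3]; push_cast; ring)
    · exact aux_step θ 3 (-1) (3 * θ + 2 * Real.pi) (by push_cast; ring)
        (by intro h; apply c3; linarith) (abs_lt.mpr ⟨by linarith, by linarith⟩)
end

section
/- Let z be a complex number with |z| > 1. Then: (i) for every real number x there exists a positive integer n with Re(z^n) ≥ x; and (ii) if moreover z is not a nonnegative real number (i.e. it is not the case that Im(z) = 0 and Re(z) ≥ 0), then for every real number x there exists a positive integer m with Re(z^m) ≤ −x. -/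
theorem aux_rec (u : ℂ) (hu : ‖u‖ = 1) (e : ℝ) (he : 0 < e) (N : ℕ) :
    ∃ n : ℕ, N ≤ n ∧ ‖u ^ n - 1‖ < e := by
  obtain ⟨a, -, φ, hφ, hlim⟩ := tendsto_subseq_of_bounded
    (x := fun n : ℕ => u ^ n) (s := Metric.closedBall (0 : ℂ) 1) Metric.isBounded_closedBall
    (by intro n; simp [hu])
  have hc := hlim.cauchySeq
  rw [Metric.cauchySeq_iff'] at hc
  obtain ⟨M, hM⟩ := hc e he
  have h1 := hM (M + N) (by omega)
  have h2 : φ M + N ≤ φ (M + N) := by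
    have := hφ.add_le_nat N M
    rw [Nat.add_comm N M] at this
    omega
  obtain ⟨d, hd⟩ := Nat.exists_eq_add_of_le h2
  refine ⟨N + d, by omega, ?_⟩
  have h3 : u ^ φ (M + N) - u ^ φ M = u ^ φ M * (u ^ (N + d) - 1) := by
    rw [hd]; ring
  simp only [Function.comp, dist_eq_norm] at h1
  rw [h3, norm_mul, norm_pow, hu, one_pow, one_mul] at h1
  exact h1

theorem aux_neg (u : ℂ) (hu : ‖u‖ = 1) (h1 : u.re < 1) : ∃ k : ℕ, (u ^ k).re < 0 := by
  by_contra! h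
  have key : ∀ j : ℕ, (2 : ℝ) ^ j * (1 - u.re) ≤ 1 - (u ^ (2 ^ j)).re := by
    intro j
    induction j with
    | zero => simp
    | succ j ih =>
      have h0 := h (2 ^ j)
      have hn : ‖u ^ (2 ^ j)‖ = 1 := by rw [norm_pow, hu, one_pow]
      have hs : (u ^ (2 ^ j)).re ^ 2 + (u ^ (2 ^ j)).im ^ 2 = 1 := by
        have := Complex.sq_norm (u ^ (2 ^ j))
        rw [hn, Complex.normSq_apply] at this
        nlinarith
      rw [pow_succ (2 : ℕ) j, pow_mul u, pow_two (u ^ 2 ^ j), Complex.mul_re, pow_succ (2 : ℝ)]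
      generalize (u ^ (2 ^ j)).re = a at *
      generalize (u ^ (2 ^ j)).im = b at *
      have ha : a ≤ 1 := by nlinarith [sq_nonneg b]
      nlinarith [mul_nonneg h0 (sub_nonneg.2 ha)]
  obtain ⟨j, hj⟩ := pow_unbounded_of_one_lt (1 / (1 - u.re)) (one_lt_two : (1 : ℝ) < 2)
  rw [div_lt_iff₀ (by linarith)] at hj
  have := key j
  have := h (2 ^ j)
  linarith

theorem aux_pow (r c x : ℝ) (hr : 1 < r) (hc : 0 < c) :
    ∃ N : ℕ, 0 < N ∧ ∀ n, N ≤ n → x ≤ r ^ n * c := by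
  obtain ⟨j, hj⟩ := pow_unbounded_of_one_lt (x / c) hr
  refine ⟨j + 1, by omega, fun n hn => ?_⟩
  rw [div_lt_iff₀ hc] at hj
  have : r ^ j ≤ r ^ n := pow_le_pow_right₀ hr.le (by omega)
  nlinarith

/-- Corollary 4.11 (computability removed): if `|z| > 1` then the real parts of
powers of `z` are unbounded above, and also unbounded below if `z` is not a
nonnegative real. -/
theorem stmt_7 (z : ℂ) (hz : 1 < ‖z‖) :
    (∀ x : ℝ, ∃ n : ℕ, 0 < n ∧ x ≤ (z ^ n).re) ∧
    (¬(z.im = 0 ∧ 0 ≤ z.re) → ∀ x : ℝ, ∃ m : ℕ, 0 < m ∧ (z ^ m).re ≤ -x) := by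
  have hr0 : 0 < ‖z‖ := by linarith
  obtain ⟨u, hu⟩ : ∃ u : ℂ, u = z / (‖z‖ : ℂ) := ⟨_, rfl⟩
  have hzu : z = (‖z‖ : ℂ) * u := by
    rw [hu, mul_div_cancel₀]
    exact_mod_cast hr0.ne'
  have hun : ‖u‖ = 1 := by
    rw [hu, norm_div, Complex.norm_real, norm_norm, div_self hr0.ne']
  have hre : ∀ n : ℕ, (z ^ n).re = ‖z‖ ^ n * (u ^ n).re := by
    intro n
    conv_lhs => rw [hzu]
    rw [mul_pow, ← Complex.ofReal_pow, Complex.re_ofReal_mul]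
  constructor
  · intro x
    obtain ⟨N, hN, h⟩ := aux_pow ‖z‖ (1 / 2) x hz (by norm_num)
    obtain ⟨n, hn, hne⟩ := aux_rec u hun (1 / 2) (by norm_num) N
    refine ⟨n, by omega, (h n hn).trans ?_⟩
    rw [hre]
    have h2 := (abs_le.1 ((Complex.abs_re_le_norm (u ^ n - 1)).trans hne.le)).1
    rw [Complex.sub_re, Complex.one_re] at h2
    exact mul_le_mul_of_nonneg_left (by linarith) (by positivity)
  · intro hnot x
    have hu1 : u.re < 1 := by
      by_contra! hge
      apply hnot
      have hs := Complex.sq_norm u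
      rw [hun, Complex.normSq_apply] at hs
      have him : u.im = 0 := by
        have : u.im * u.im ≤ 0 := by nlinarith
        exact mul_self_eq_zero.1 (le_antisymm this (mul_self_nonneg _))
      rw [hzu, Complex.re_ofReal_mul, Complex.im_ofReal_mul, him]
      exact ⟨by simp, by positivity⟩
    obtain ⟨k, hk⟩ := aux_neg u hun hu1
    obtain ⟨c, hc⟩ : ∃ c, c = -(u ^ k).re / 2 := ⟨_, rfl⟩
    have hc0 : 0 < c := by rw [hc]; linarith
    obtain ⟨N, hN, h⟩ := aux_pow ‖z‖ c x hz hc0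
    obtain ⟨n, hn, hne⟩ := aux_rec u hun c hc0 N
    refine ⟨n + k, by omega, ?_⟩
    have h1 := h (n + k) (by omega)
    rw [hre]
    have h3 : ‖u ^ (n + k) - u ^ k‖ < c := by
      have : u ^ (n + k) - u ^ k = (u ^ n - 1) * u ^ k := by ring
      rw [this, norm_mul, norm_pow, hun, one_pow, mul_one]
      exact hne
    have h2 := (abs_le.1 ((Complex.abs_re_le_norm _).trans h3.le)).2
    rw [Complex.sub_re] at h2
    have h4 : (u ^ (n + k)).re ≤ -c := by linarith
    have h5 := mul_le_mul_of_nonneg_left h4 (by positivity : 0 ≤ ‖z‖ ^ (n + k))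
    linarith
end

section
/- Let y be a nonzero complex number whose principal argument Arg(y) ∈ [0, 2π) does not belong to {0, π/2, 2π/3, π, 4π/3, 3π/2}; equivalently, Re(y) ≠ 0, Im(y) ≠ 0, and y³ is not a positive real number. Then there exists a positive integer n such that Re(y^n) > 0 and Im(y^n) > 0. -/
lemma aux_pow_s8 (y : ℂ) (n : ℕ) (j : ℤ) (s : ℝ)
    (h : (n : ℝ) * (y.arg / (2 * Real.pi)) = j + s) :
    (y ^ n).re = ‖y‖ ^ n * Real.cos (s * (2 * Real.pi)) ∧
    (y ^ n).im = ‖y‖ ^ n * Real.sin (s * (2 * Real.pi)) := by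
  have hpi := Real.pi_pos
  have h1 : (n : ℝ) * y.arg = s * (2 * Real.pi) + j * (2 * Real.pi) := by
    field_simp at h
    linarith
  have h2 : y ^ n = ((‖y‖ ^ n : ℝ) : ℂ) * Complex.exp (((n : ℝ) * y.arg : ℝ) * Complex.I) := by
    conv_lhs => rw [← Complex.norm_mul_exp_arg_mul_I y]
    rw [mul_pow, ← Complex.exp_nat_mul]
    push_cast
    ring_nf
  rw [h2, Complex.re_ofReal_mul, Complex.im_ofReal_mul, Complex.exp_ofReal_mul_I_re,
    Complex.exp_ofReal_mul_I_im, h1, Real.cos_add_int_mul_two_pi, Real.sin_add_int_mul_two_pi]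
  exact ⟨rfl, rfl⟩

lemma aux_good (y : ℂ) (hy : y ≠ 0) (n : ℕ) (j : ℤ) (s : ℝ)
    (h : (n : ℝ) * (y.arg / (2 * Real.pi)) = j + s) (h0 : 0 < s) (h1 : s < 1 / 4) :
    0 < (y ^ n).re ∧ 0 < (y ^ n).im := by
  have hpi := Real.pi_pos
  obtain ⟨hr, hi⟩ := aux_pow_s8 y n j s h
  have hn : 0 < ‖y‖ ^ n := pow_pos (norm_pos_iff.mpr hy) n
  have hs : 0 < s * (2 * Real.pi) := by positivity
  have hs' : s * (2 * Real.pi) < Real.pi / 2 := by nlinarith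
  rw [hr, hi]
  exact ⟨mul_pos hn (Real.cos_pos_of_mem_Ioo ⟨by linarith, hs'⟩),
    mul_pos hn (Real.sin_pos_of_pos_of_lt_pi hs (by linarith))⟩

/-- Core of Lemma 5.2: if `y ≠ 0` is neither real, nor purely imaginary, nor has
`y³` a positive real, then some power of `y` lies in the open first quadrant. -/
theorem stmt_8 (y : ℂ) (hy : y ≠ 0) (hre : y.re ≠ 0) (him : y.im ≠ 0)
    (hcube : ¬((y ^ 3).im = 0 ∧ 0 < (y ^ 3).re)) :
    ∃ n : ℕ, 0 < n ∧ 0 < (y ^ n).re ∧ 0 < (y ^ n).im := by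
  obtain ⟨j, k, hk0, hk4, hjk⟩ := Real.exists_int_int_abs_mul_sub_le
    (y.arg / (2 * Real.pi)) (n := 4) (by norm_num)
  lift k to ℕ using hk0.le
  have hk0' : 0 < k := by exact_mod_cast hk0
  have hk4' : k ≤ 4 := by exact_mod_cast hk4
  obtain ⟨d, hd⟩ : ∃ d : ℝ, d = y.arg / (2 * Real.pi) * k - j := ⟨_, rfl⟩
  have hd5 : |d| ≤ 1 / 5 := by
    rw [hd]
    push_cast at hjk
    norm_num at hjk ⊢
    first | exact hjk | (rw [mul_comm]; exact hjk)
  obtain ⟨hl, hu⟩ := abs_le.mp hd5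
  rcases lt_trichotomy d 0 with hneg | hz | hpos
  · obtain ⟨m, hm⟩ : ∃ m : ℕ, m = ⌊(3 / 4) / (-d)⌋₊ := ⟨_, rfl⟩
    have hq : 0 ≤ (3 / 4) / (-d) := div_nonneg (by norm_num) (by linarith)
    have h1 : (m : ℝ) * (-d) ≤ 3 / 4 := by
      rw [← le_div_iff₀ (by linarith), hm]
      exact Nat.floor_le hq
    have h2 : 3 / 4 < ((m : ℝ) + 1) * (-d) := by
      rw [← div_lt_iff₀ (by linarith), hm]
      exact Nat.lt_floor_add_one _
    refine ⟨(m + 1) * k, by positivity, ?_⟩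
    apply aux_good y hy _ ((m + 1) * j - 1) (1 + (m + 1) * d)
    · push_cast
      rw [hd]
      ring
    · linarith
    · linarith
  · exfalso
    obtain ⟨hr, hi⟩ := aux_pow_s8 y k j 0 (by linarith)
    have hn : 0 < ‖y‖ ^ k := pow_pos (norm_pos_iff.mpr hy) k
    simp only [zero_mul, Real.cos_zero, Real.sin_zero, mul_one, mul_zero] at hr hi
    rw [← hr] at hn
    clear hr hjk hd
    interval_cases k
    · exact him (by simpa using hi)
    · simp [pow_succ] at hi
      have : y.re * y.im = 0 := by linarith
      simp_all
    · exact hcube ⟨hi, hn⟩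
    · simp only [pow_succ, pow_zero, one_mul, Complex.mul_re, Complex.mul_im] at hi hn
      have h1 : (y.re * y.im) * (y.re ^ 2 - y.im ^ 2) = 0 := by linarith
      have h2 : y.re ^ 2 - y.im ^ 2 = 0 :=
        (mul_eq_zero.mp h1).resolve_left (mul_ne_zero hre him)
      have h3 : 0 < y.re ^ 2 := by positivity
      have h4 : 0 < (y.re ^ 2 - y.im ^ 2) ^ 2 - 4 * (y.re ^ 2 * y.im ^ 2) := by linarith
      have h5 : y.im ^ 2 = y.re ^ 2 := by linarith
      rw [h5] at h4
      nlinarith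
  · exact ⟨k, hk0', aux_good y hy k j d (by linarith) hpos (by linarith)⟩
end

section
/- Let r and c be rational numbers with 0 < r < 1 and 0 < c < 1. Let (z_n)_{n≥1} be a sequence of complex numbers such that for every n ≥ 1: |z_n| < 1, Re(z_n) = 1 − f(n), and Im(z_n) = g(n), where f and g satisfy c·r^n ≤ f(n) ≤ r^n/2 and c·r^n ≤ g(n) ≤ r^n/2. Then there exist a real number w with 0 < w < 1 and a sequence (e_n)_{n≥1} of nonnegative integers which is bounded above, such that for every positive integer n, |∏_{j=1}^{n} z_j^{e_j} − w| ≤ (π/2 + π/(c·(1 − r)))·r^n. -/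
/-- Remaining angle in the greedy construction. -/
noncomputable def remAngle (t : ℕ → ℝ) : ℕ → ℝ
  | 0 => 2 * Real.pi
  | n + 1 => remAngle t n - (⌊remAngle t n / t (n + 1)⌋₊ : ℝ) * t (n + 1)

theorem aux_arg (z : ℂ) (x f g c : ℝ) (hc : 0 < c) (hx : 0 < x) (hx1 : x ≤ 1) (hz : ‖z‖ < 1)
    (hre : z.re = 1 - f) (him : z.im = g) (hf : f ≤ x / 2)
    (hg : c * x ≤ g) (hg' : g ≤ x / 2) :
    c * x ≤ z.arg ∧ z.arg ≤ x ∧ 1 - ‖z‖ ≤ x / 2 ∧ 0 < ‖z‖ := by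
  have hre0 : 1 / 2 ≤ z.re := by linarith
  have hcx : 0 < c * x := by positivity
  have hn : z.re ≤ ‖z‖ := Complex.re_le_norm z
  have hn0 : 0 < ‖z‖ := by linarith
  have ha0 : 0 ≤ z.arg := Complex.arg_nonneg_iff.2 (by linarith)
  have ha1 : z.arg < Real.pi / 2 := by
    have := (Complex.abs_arg_lt_pi_div_two_iff (z := z)).2 (Or.inl (by linarith))
    exact (abs_lt.1 this).2
  refine ⟨?_, ?_, by linarith, hn0⟩
  · have h1 := Real.sin_le ha0
    rw [Complex.sin_arg, him] at h1
    have : g ≤ g / ‖z‖ := by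
      rw [le_div_iff₀ hn0]; nlinarith
    linarith
  · have h1 := Real.le_tan ha0 ha1
    rw [Complex.tan_arg, him] at h1
    refine h1.trans ?_
    rw [div_le_iff₀ (by linarith)]
    nlinarith

/-- Lemma 5.5 (computability removed): for a sequence `z_n` in the open unit
disc with `z_n = 1 - f(n) + i g(n)` and `c r^n ≤ f(n), g(n) ≤ r^n/2`, there is
`w ∈ (0,1)` and a bounded sequence of nonnegative integer exponents `e_n` with
`|∏_{j=1}^n z_j^{e_j} - w| ≤ (π/2 + π/(c(1-r))) r^n` for all `n ≥ 1`. -/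
theorem stmt_10 (r c : ℚ) (hr0 : 0 < r) (hr1 : r < 1) (hc0 : 0 < c) (hc1 : c < 1)
    (z : ℕ → ℂ) (f g : ℕ → ℝ)
    (hz1 : ∀ n : ℕ, 1 ≤ n → ‖z n‖ < 1)
    (hre : ∀ n : ℕ, 1 ≤ n → (z n).re = 1 - f n)
    (him : ∀ n : ℕ, 1 ≤ n → (z n).im = g n)
    (hf : ∀ n : ℕ, 1 ≤ n → (c : ℝ) * (r : ℝ) ^ n ≤ f n ∧ f n ≤ (r : ℝ) ^ n / 2)
    (hg : ∀ n : ℕ, 1 ≤ n → (c : ℝ) * (r : ℝ) ^ n ≤ g n ∧ g n ≤ (r : ℝ) ^ n / 2) :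
    ∃ w : ℝ, 0 < w ∧ w < 1 ∧ ∃ e : ℕ → ℕ, (∃ B : ℕ, ∀ n, e n ≤ B) ∧
      ∀ n : ℕ, 1 ≤ n →
        ‖(∏ j ∈ Finset.Icc 1 n, z j ^ e j) - (w : ℂ)‖ ≤
          (Real.pi / 2 + Real.pi / ((c : ℝ) * (1 - (r : ℝ)))) * (r : ℝ) ^ n := by
  have hR0 : (0 : ℝ) < r := by exact_mod_cast hr0
  have hR1 : (r : ℝ) < 1 := by exact_mod_cast hr1
  have hC0 : (0 : ℝ) < c := by exact_mod_cast hc0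
  generalize (r : ℝ) = r at *
  generalize (c : ℝ) = c at *
  have hrp : ∀ n : ℕ, 0 < r ^ n := fun n => pow_pos hR0 n
  have hrp1 : ∀ n : ℕ, r ^ n ≤ 1 := fun n => pow_le_one₀ hR0.le hR1.le
  have key : ∀ n : ℕ, 1 ≤ n → c * r ^ n ≤ (z n).arg ∧ (z n).arg ≤ r ^ n ∧
      1 - ‖z n‖ ≤ r ^ n / 2 ∧ 0 < ‖z n‖ := fun n hn =>
    aux_arg (z n) (r ^ n) (f n) (g n) c hC0 (hrp n) (hrp1 n) (hz1 n hn) (hre n hn) (him n hn)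
      (hf n hn).2 (hg n hn).1 (hg n hn).2
  have htp : ∀ n : ℕ, 0 < (z (n + 1)).arg := fun n =>
    lt_of_lt_of_le (mul_pos hC0 (hrp _)) (key (n + 1) (by omega)).1
  set t : ℕ → ℝ := fun n => (z n).arg with ht
  have htp' : ∀ n : ℕ, 0 < t (n + 1) := htp
  set R : ℕ → ℝ := remAngle t with hR
  have hRz : R 0 = 2 * Real.pi := rfl
  set e : ℕ → ℕ := fun n => ⌊R (n - 1) / t n⌋₊ with he
  have hes : ∀ n, e (n + 1) = ⌊R n / t (n + 1)⌋₊ := fun n => rfl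
  have hRs : ∀ n, R (n + 1) = R n - (e (n + 1) : ℝ) * t (n + 1) := fun n => rfl
  have hRnn : ∀ n, 0 ≤ R n := by
    intro n
    induction n with
    | zero => rw [hRz]; positivity
    | succ n ih =>
      rw [hRs, hes]
      have h := Nat.floor_le (div_nonneg ih (htp' n).le)
      rw [le_div_iff₀ (htp' n)] at h
      linarith
  have hRle : ∀ n, R (n + 1) ≤ r ^ (n + 1) := by
    intro n
    have h := Nat.lt_floor_add_one (R n / t (n + 1))
    rw [div_lt_iff₀ (htp' n)] at h
    have h2 : t (n + 1) ≤ r ^ (n + 1) := (key (n + 1) (by omega)).2.1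
    rw [hRs, hes]
    nlinarith
  have hele : ∀ n, (e (n + 1) : ℝ) * (c * r ^ (n + 1)) ≤ R n := by
    intro n
    have h := Nat.floor_le (div_nonneg (hRnn n) (htp' n).le)
    rw [le_div_iff₀ (htp' n), ← hes] at h
    refine le_trans ?_ h
    exact mul_le_mul_of_nonneg_left (key (n + 1) (by omega)).1 (Nat.cast_nonneg _)
  have hele2 : ∀ n, (e (n + 2) : ℝ) * (c * r) ≤ 1 := by
    intro n
    have h := (hele (n + 1)).trans (hRle n)
    have h3 : (e (n + 2) : ℝ) * (c * r) * r ^ (n + 1) ≤ 1 * r ^ (n + 1) := by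
      calc _ = (e (n + 1 + 1) : ℝ) * (c * r ^ (n + 1 + 1)) := by rw [pow_succ r (n + 1)]; ring
        _ ≤ _ := by linarith
    exact le_of_mul_le_mul_right h3 (hrp _)
  have hcr : 0 < c * r := by positivity
  have he1 : 1 ≤ e 1 := by
    rw [show (1 : ℕ) = 0 + 1 from rfl, hes, Nat.le_floor_iff (div_nonneg (hRnn 0) (htp' 0).le),
      le_div_iff₀ (htp' 0), hRz]
    have h2 : t (0 + 1) ≤ r ^ (0 + 1) := (key (0 + 1) (by omega)).2.1
    have := hrp1 (0 + 1)
    have := Real.pi_gt_three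
    push_cast
    linarith
  set ρ : ℕ → ℝ := fun n => ∏ j ∈ Finset.Icc 1 n, ‖z j‖ ^ e j with hρ
  have hρ0 : ρ 0 = 1 := by simp [hρ]
  have hρs : ∀ n, ρ (n + 1) = ρ n * ‖z (n + 1)‖ ^ e (n + 1) := fun n => by
    simp only [hρ]
    rw [Finset.prod_Icc_succ_top (by omega)]
  have hρpos : ∀ n, 0 < ρ n := fun n => Finset.prod_pos fun j hj =>
    pow_pos (key j (Finset.mem_Icc.1 hj).1).2.2.2 _
  have hanti : Antitone ρ := antitone_nat_of_succ_le fun n => by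
    rw [hρs]
    exact mul_le_of_le_one_right (hρpos n).le
      (pow_le_one₀ (norm_nonneg _) (hz1 (n + 1) (by omega)).le)
  have hρle1 : ∀ n, ρ n ≤ 1 := fun n => hρ0 ▸ hanti (Nat.zero_le n)
  obtain ⟨K, hK⟩ : ∃ K, K = 1 / (2 * (c * (1 - r))) := ⟨_, rfl⟩
  have h1r : 0 < 1 - r := by linarith
  have hKpos : 0 < K := by rw [hK]; positivity
  have hKm : K * (1 - r) * c = 1 / 2 := by rw [hK]; field_simp
  have hlow : ∀ n k, ρ (n + 1) * (1 - K * (r ^ (n + 1) - r ^ (n + 1 + k))) ≤ ρ (n + 1 + k) := by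
    intro n k
    induction k with
    | zero => simp
    | succ k ih =>
      have hm : n + 1 + (k + 1) = (n + k) + 2 := by omega
      have hm1 : n + 1 + k = (n + k) + 1 := by omega
      rw [hm1] at ih
      rw [hm]
      have hnm : n ≤ n + k := by omega
      clear hm hm1
      generalize n + k = m at ih hnm ⊢
      have hk := (key (m + 2) (by omega)).2.2.1
      have hb := one_add_mul_le_pow (a := ‖z (m + 2)‖ - 1)
        (by linarith [norm_nonneg (z (m + 2))]) (e (m + 2))
      rw [add_sub_cancel] at hb
      have hd : (e (m + 2) : ℝ) * (1 - ‖z (m + 2)‖) ≤ K * (r ^ (m + 1) - r ^ (m + 2)) := by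
        have h1 : (e (m + 2) : ℝ) * (1 - ‖z (m + 2)‖) ≤ e (m + 2) * (r ^ (m + 2) / 2) :=
          mul_le_mul_of_nonneg_left hk (Nat.cast_nonneg _)
        refine h1.trans ?_
        have h2 := mul_le_mul_of_nonneg_right (hele2 m)
          (mul_nonneg (mul_nonneg hKpos.le h1r.le) (hrp (m + 1)).le)
        calc _ = (e (m + 2) : ℝ) * r ^ (m + 2) * (1 / 2) := by ring
          _ = (e (m + 2) : ℝ) * (c * r) * (K * (1 - r) * r ^ (m + 1)) := by rw [← hKm]; ring
          _ ≤ _ := h2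
          _ = _ := by ring
      have hdp : 0 ≤ K * (r ^ (m + 1) - r ^ (m + 2)) := by
        have : r ^ (m + 1) - r ^ (m + 2) = r ^ (m + 1) * (1 - r) := by ring
        rw [this]; have := hrp (m + 1); positivity
      have hmn : ρ (m + 1) * (K * (r ^ (m + 1) - r ^ (m + 2))) ≤
          ρ (n + 1) * (K * (r ^ (m + 1) - r ^ (m + 2))) :=
        mul_le_mul_of_nonneg_right (hanti (by omega)) hdp
      have hb2 : 1 - K * (r ^ (m + 1) - r ^ (m + 2)) ≤ ‖z (m + 2)‖ ^ e (m + 2) := by linarith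
      have h5 := mul_le_mul_of_nonneg_left hb2 (hρpos (m + 1)).le
      rw [hρs (m + 1)]
      linarith
  have hbdd : BddBelow (Set.range ρ) := ⟨0, by rintro _ ⟨n, rfl⟩; exact (hρpos n).le⟩
  obtain ⟨w, hw⟩ : ∃ w, w = ⨅ n, ρ n := ⟨_, rfl⟩
  have hwle : ∀ n, w ≤ ρ n := fun n => hw ▸ ciInf_le hbdd n
  have hwge : ∀ n, ρ (n + 1) * (1 - K * r ^ (n + 1)) ≤ w := by
    intro n
    rw [hw]
    refine le_ciInf fun m => ?_
    refine le_trans ?_ ((hlow n m).trans (hanti (by omega)))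
    refine mul_le_mul_of_nonneg_left ?_ (hρpos _).le
    have := mul_pos hKpos (hrp (n + 1 + m))
    linarith
  have hP : ∀ n, (∏ j ∈ Finset.Icc 1 n, z j ^ e j) =
      (ρ n : ℂ) * Complex.exp (Complex.I * ((-R n : ℝ) : ℂ)) := by
    intro n
    induction n with
    | zero =>
      rw [hρ0, hRz]
      have : Complex.I * ((-(2 * Real.pi) : ℝ) : ℂ) = -(2 * Real.pi * Complex.I) := by
        push_cast; ring
      rw [this, Complex.exp_neg, Complex.exp_two_pi_mul_I]; simp
    | succ n ih =>
      rw [Finset.prod_Icc_succ_top (by omega), ih, hρs, hRs]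
      have hzz : z (n + 1) = (‖z (n + 1)‖ : ℂ) * Complex.exp ((t (n + 1) : ℂ) * Complex.I) :=
        (Complex.norm_mul_exp_arg_mul_I _).symm
      conv_lhs => rw [hzz]
      rw [mul_pow, ← Complex.exp_nat_mul, mul_mul_mul_comm, ← Complex.exp_add]
      push_cast
      congr 2
      ring
  refine ⟨w, ?_, ?_, e, ?_, ?_⟩
  · obtain ⟨n, hn⟩ := exists_pow_lt_of_lt_one (show 0 < 1 / K by positivity) hR1
    have h1 : r ^ (n + 1) ≤ r ^ n := pow_le_pow_of_le_one hR0.le hR1.le (by omega)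
    have h2 : K * r ^ (n + 1) < 1 := by
      have := lt_of_le_of_lt h1 hn
      rw [lt_div_iff₀ hKpos] at this
      linarith
    exact lt_of_lt_of_le (mul_pos (hρpos _) (by linarith)) (hwge n)
  · refine lt_of_le_of_lt (hwle 1) ?_
    rw [show (1 : ℕ) = 0 + 1 from rfl, hρs, hρ0, one_mul]
    exact pow_lt_one₀ (norm_nonneg _) (hz1 1 le_rfl) (by simpa using Nat.one_le_iff_ne_zero.1 he1)
  · refine ⟨e 0 + e 1 + ⌊1 / (c * r)⌋₊, fun n => ?_⟩
    match n with
    | 0 => omega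
    | 1 => omega
    | n + 2 =>
      have : e (n + 2) ≤ ⌊1 / (c * r)⌋₊ := Nat.le_floor (by
        rw [le_div_iff₀ hcr]; exact hele2 n)
      omega
  · intro n hn
    obtain ⟨m, rfl⟩ : ∃ m, n = m + 1 := ⟨n - 1, by omega⟩
    rw [hP]
    have hsplit : (ρ (m + 1) : ℂ) * Complex.exp (Complex.I * ((-R (m + 1) : ℝ) : ℂ)) - (w : ℂ) =
        (ρ (m + 1) : ℂ) * (Complex.exp (Complex.I * ((-R (m + 1) : ℝ) : ℂ)) - 1) +
          ((ρ (m + 1) - w : ℝ) : ℂ) := by push_cast; ring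
    rw [hsplit]
    refine (norm_add_le _ _).trans ?_
    rw [norm_mul, Complex.norm_real, Complex.norm_real, Real.norm_of_nonneg (hρpos _).le,
      Real.norm_of_nonneg (sub_nonneg.2 (hwle _))]
    have h1 := Real.norm_exp_I_mul_ofReal_sub_one_le (x := -R (m + 1))
    rw [norm_neg, Real.norm_of_nonneg (hRnn _)] at h1
    have h2 := h1.trans (hRle m)
    have h3 : ρ (m + 1) * ‖Complex.exp (Complex.I * ((-R (m + 1) : ℝ) : ℂ)) - 1‖ ≤ 1 * r ^ (m + 1) :=
      mul_le_mul (hρle1 _) h2 (norm_nonneg _) zero_le_one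
    have h4 : ρ (m + 1) - w ≤ K * r ^ (m + 1) := by
      have := hwge m
      have h6 := mul_le_mul_of_nonneg_right (hρle1 (m + 1)) (mul_pos hKpos (hrp (m + 1))).le
      linarith
    have h5 : K ≤ Real.pi / (c * (1 - r)) := by
      have : K = (1 / 2) / (c * (1 - r)) := by rw [hK]; field_simp
      rw [this]
      gcongr
      linarith [Real.pi_gt_three]
    have h7 : 1 + K ≤ Real.pi / 2 + Real.pi / (c * (1 - r)) := by linarith [Real.pi_gt_three]
    have h8 := mul_le_mul_of_nonneg_right h7 (hrp (m + 1)).le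
    linarith
end

section
/- Let q and γ be complex numbers, each algebraic over ℚ. Then there exists a rational number C > 1 such that for every multigraph (given by n, m and ends : Fin m → Sym2 (Fin n)), the Tutte partition function Z(q, γ) satisfies: either Z(q, γ) = 0, or |Z(q, γ)| ≥ C^{−(n+m)}. -/
open scoped Classical

/-- Number of connected components of the simple graph on `Fin n` determined by
the edge subset `A` of a multigraph given by `ends : Fin m → Sym2 (Fin n)`. -/
noncomputable def numComponents {n m : ℕ} (ends : Fin m → Sym2 (Fin n))
    (A : Finset (Fin m)) : ℕ :=
  Nat.card (SimpleGraph.fromEdgeSet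
    ((A.image ends : Finset (Sym2 (Fin n))) : Set (Sym2 (Fin n)))).ConnectedComponent

/-- The random-cluster Tutte partition function `Z(q, γ)` of a multigraph. -/
noncomputable def tutteZ {K : Type*} [Field K] {n m : ℕ}
    (ends : Fin m → Sym2 (Fin n)) (q γ : K) : K :=
  ∑ A : Finset (Fin m), q ^ numComponents ends A * γ ^ A.card

/-- The contribution `Z_{st}(q, γ)` from edge subsets where `s` and `t` lie in
the same connected component. -/
noncomputable def tutteZst {K : Type*} [Field K] {n m : ℕ}
    (ends : Fin m → Sym2 (Fin n)) (q γ : K) (s t : Fin n) : K :=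
  ∑ A : Finset (Fin m),
    if (SimpleGraph.fromEdgeSet
        ((A.image ends : Finset (Sym2 (Fin n))) : Set (Sym2 (Fin n)))).Reachable s t
    then q ^ numComponents ends A * γ ^ A.card else 0

/-- The contribution `Z_{s|t}(q, γ) = Z(q, γ) - Z_{st}(q, γ)` from edge subsets
where `s` and `t` lie in different connected components. -/
noncomputable def tutteZsplit {K : Type*} [Field K] {n m : ℕ}
    (ends : Fin m → Sym2 (Fin n)) (q γ : K) (s t : Fin n) : K :=
  tutteZ ends q γ - tutteZst ends q γ s t

lemma tutteZ_map' {K L : Type*} [Field K] [Field L] (φ : K →+* L) {n m : ℕ}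
    (ends : Fin m → Sym2 (Fin n)) (a b : K) :
    φ (tutteZ ends a b) = tutteZ ends (φ a) (φ b) := by
  simp [tutteZ]

lemma numComponents_le' {n m : ℕ} (ends : Fin m → Sym2 (Fin n)) (A : Finset (Fin m)) :
    numComponents ends A ≤ n := by
  unfold numComponents
  have h := Nat.card_le_card_of_surjective
    (SimpleGraph.fromEdgeSet
      ((A.image ends : Finset (Sym2 (Fin n))) : Set (Sym2 (Fin n)))).connectedComponentMk
    (fun c => Quot.exists_rep c)
  simpa using h

lemma tutteZ_norm_le' {n m : ℕ} (ends : Fin m → Sym2 (Fin n)) (a b : ℂ) (M : ℝ) (hM : 1 ≤ M)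
    (ha : ‖a‖ ≤ M) (hb : ‖b‖ ≤ M) : ‖tutteZ ends a b‖ ≤ (2 * M) ^ (n + m) := by
  have h1 : ‖tutteZ ends a b‖ ≤ ∑ A : Finset (Fin m), M ^ (n + m) := by
    refine norm_sum_le_of_le _ fun A _ => ?_
    rw [norm_mul, norm_pow, norm_pow, pow_add]
    have hA : A.card ≤ m := by simpa using A.card_le_univ
    gcongr
    · exact (pow_le_pow_left₀ (norm_nonneg _) ha _).trans
        (pow_le_pow_right₀ hM (numComponents_le' ends A))
    · exact (pow_le_pow_left₀ (norm_nonneg _) hb _).trans (pow_le_pow_right₀ hM hA)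
  refine h1.trans ?_
  rw [Finset.sum_const, nsmul_eq_mul, mul_pow]
  gcongr
  have : (2:ℝ) ^ m ≤ 2 ^ (n + m) := pow_le_pow_right₀ (by norm_num) (by omega)
  simpa using this

lemma tutteZ_integral' {K : Type*} [Field K] {n m : ℕ} (ends : Fin m → Sym2 (Fin n)) (a b : K)
    (d : ℤ) (ha : IsIntegral ℤ ((d : K) * a)) (hb : IsIntegral ℤ ((d : K) * b)) :
    IsIntegral ℤ ((d : K) ^ (n + m) * tutteZ ends a b) := by
  unfold tutteZ
  rw [Finset.mul_sum]
  refine IsIntegral.sum _ fun A _ => ?_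
  have hA : A.card ≤ m := by simpa using A.card_le_univ
  have hd : IsIntegral ℤ (d : K) := by simpa using (isIntegral_algebraMap (R := ℤ) (A := K) (x := d))
  obtain ⟨r, hr⟩ := Nat.exists_eq_add_of_le (numComponents_le' ends A)
  obtain ⟨s, hs⟩ := Nat.exists_eq_add_of_le hA
  have : (d : K) ^ (n + m) * (a ^ numComponents ends A * b ^ A.card)
      = ((d : K) * a) ^ numComponents ends A * ((d : K) * b) ^ A.card * (d : K) ^ (r + s) := by
    have e : n + m = numComponents ends A + A.card + (r + s) := by omega
    rw [e]; ring
  rw [this]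
  exact ((ha.pow _).mul (hb.pow _)).mul (hd.pow _)

lemma integral_lower' {K : Type*} [Field K] [NumberField K] (x : K) (hx : IsIntegral ℤ x)
    (h0 : x ≠ 0) (T : ℝ) (hT : 1 ≤ T) (h : ∀ φ : K →ₐ[ℚ] ℂ, ‖φ x‖ ≤ T) (φ₀ : K →ₐ[ℚ] ℂ) :
    1 ≤ ‖φ₀ x‖ * T ^ Module.finrank ℚ K := by
  have hn := Algebra.norm_eq_prod_embeddings ℚ ℂ x
  obtain ⟨z, hz⟩ := IsIntegrallyClosed.isIntegral_iff.1 (Algebra.isIntegral_norm ℚ hx)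
  have hz0 : z ≠ 0 := by
    rintro rfl
    simp only [map_zero] at hz
    exact h0 (Algebra.norm_eq_zero_iff.1 hz.symm)
  have h1 : (1 : ℝ) ≤ ∏ φ : K →ₐ[ℚ] ℂ, ‖φ x‖ := by
    rw [← norm_prod, ← hn, ← hz]
    simp only [eq_intCast, map_intCast, Complex.norm_intCast]
    exact_mod_cast Int.one_le_abs hz0
  refine h1.trans ?_
  rw [← Finset.mul_prod_erase _ _ (Finset.mem_univ φ₀)]
  gcongr
  refine (Finset.prod_le_prod (fun φ _ => norm_nonneg _) fun φ _ => h φ).trans ?_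
  rw [Finset.prod_const]
  refine pow_le_pow_right₀ hT ?_
  rw [← AlgHom.card ℚ K ℂ]
  exact Finset.card_le_univ _

lemma core' {K : Type*} [Field K] [NumberField K] (a b : K) (φ₀ : K →ₐ[ℚ] ℂ) :
    ∃ C : ℚ, 1 < C ∧
      ∀ (n m : ℕ) (ends : Fin m → Sym2 (Fin n)),
        tutteZ ends (φ₀ a) (φ₀ b) = 0 ∨
          (C : ℝ) ^ (-((n + m : ℕ) : ℤ)) ≤ ‖tutteZ ends (φ₀ a) (φ₀ b)‖ := by
  obtain ⟨d, hd0, hd⟩ : ∃ d : ℤ, d ≠ 0 ∧ IsIntegral ℤ ((d : K) * a) ∧ IsIntegral ℤ ((d : K) * b) := by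
    have alg : ∀ x : K, IsAlgebraic ℤ x := fun x =>
      (IsFractionRing.isAlgebraic_iff ℤ ℚ K).2 (Algebra.IsAlgebraic.isAlgebraic x)
    obtain ⟨y, hy, hya⟩ := (alg a).exists_integral_multiple
    obtain ⟨z, hz, hzb⟩ := (alg b).exists_integral_multiple
    refine ⟨y * z, mul_ne_zero hy hz, ?_, ?_⟩
    · have := hya.smul z
      simpa [zsmul_eq_mul, mul_comm, mul_assoc, mul_left_comm] using this
    · have := hzb.smul y
      simpa [zsmul_eq_mul, mul_comm, mul_assoc, mul_left_comm] using this
  obtain ⟨M, hM⟩ : ∃ M : ℕ, 1 ≤ M ∧ ∀ φ : K →ₐ[ℚ] ℂ, ‖φ a‖ ≤ M ∧ ‖φ b‖ ≤ M := by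
    obtain ⟨M, hM⟩ := exists_nat_ge (1 + ∑ φ : K →ₐ[ℚ] ℂ, (‖φ a‖ + ‖φ b‖))
    have key : ∀ φ : K →ₐ[ℚ] ℂ, ‖φ a‖ + ‖φ b‖ ≤ ∑ φ : K →ₐ[ℚ] ℂ, (‖φ a‖ + ‖φ b‖) := fun φ =>
      Finset.single_le_sum (f := fun φ : K →ₐ[ℚ] ℂ => ‖φ a‖ + ‖φ b‖)
        (fun i _ => by positivity) (Finset.mem_univ φ)
    refine ⟨M, ?_, fun φ => ?_⟩
    · have := key φ₀
      have h1 : (1:ℝ) ≤ M := by linarith [norm_nonneg (φ₀ a), norm_nonneg (φ₀ b)]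
      exact_mod_cast h1
    · have := key φ
      constructor <;> linarith [norm_nonneg (φ a), norm_nonneg (φ b)]
  obtain ⟨hM1, hM⟩ := hM
  have hM1' : (1:ℝ) ≤ M := by exact_mod_cast hM1
  have hd1 : 1 ≤ d.natAbs := Int.natAbs_pos.2 hd0
  have hd1' : (1:ℝ) ≤ d.natAbs := by exact_mod_cast hd1
  have hdn : ‖(d:ℂ)‖ = d.natAbs := by
    rw [Complex.norm_intCast, Nat.cast_natAbs, Int.cast_abs]
  set D := Module.finrank ℚ K
  set B : ℕ := d.natAbs * (2 * M)
  have hB1 : 1 ≤ B := Nat.one_le_iff_ne_zero.2 (by positivity)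
  have hB1' : (1:ℝ) ≤ B := by exact_mod_cast hB1
  set E : ℕ := d.natAbs * B ^ D
  have hE : 1 ≤ E := Nat.one_le_iff_ne_zero.2 (by positivity)
  refine ⟨(E : ℚ) + 1, by have : (1:ℚ) ≤ E := by exact_mod_cast hE
                          linarith, fun n m ends => ?_⟩
  rw [or_iff_not_imp_left]
  intro hZ
  have hmap : ∀ φ : K →ₐ[ℚ] ℂ, φ ((d : K) ^ (n + m) * tutteZ ends a b) =
      (d : ℂ) ^ (n + m) * tutteZ ends (φ a) (φ b) := fun φ => by
    have := tutteZ_map' (φ : K →+* ℂ) ends a b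
    simp only [RingHom.coe_coe] at this
    rw [map_mul, this]; simp
  have hx0 : (d : K) ^ (n + m) * tutteZ ends a b ≠ 0 := by
    intro h
    have := hmap φ₀
    rw [h, map_zero] at this
    rcases mul_eq_zero.1 this.symm with h | h
    · exact hd0 (by have h2 := pow_ne_zero (n + m) (Int.cast_ne_zero (α := ℂ).2 hd0); exact absurd h h2)
    · exact hZ h
  have key := integral_lower' _ (tutteZ_integral' ends a b d hd.1 hd.2) hx0
    ((B:ℝ) ^ (n + m)) (one_le_pow₀ hB1') (fun φ => by
      rw [hmap, norm_mul, norm_pow, hdn]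
      have := tutteZ_norm_le' ends (φ a) (φ b) M hM1' (hM φ).1 (hM φ).2
      simp only [B, Nat.cast_mul, Nat.cast_ofNat]
      rw [mul_pow (d.natAbs : ℝ)]
      gcongr) φ₀
  rw [hmap, norm_mul, norm_pow, hdn] at key
  have hEq : (d.natAbs : ℝ) ^ (n + m) * ‖tutteZ ends (φ₀ a) (φ₀ b)‖ *
      ((B:ℝ) ^ (n + m)) ^ D = (E:ℝ) ^ (n + m) * ‖tutteZ ends (φ₀ a) (φ₀ b)‖ := by
    simp only [E, Nat.cast_mul, Nat.cast_pow]
    ring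
  change 1 ≤ _ * ((B:ℝ) ^ (n + m)) ^ D at key
  rw [hEq] at key
  rw [zpow_neg, zpow_natCast, inv_le_iff_one_le_mul₀' (by push_cast; positivity)]
  refine key.trans ?_
  gcongr
  push_cast
  linarith

theorem stmt_11 (q γ : ℂ) (hq : IsAlgebraic ℚ q) (hγ : IsAlgebraic ℚ γ) :
    ∃ C : ℚ, 1 < C ∧
      ∀ (n m : ℕ) (ends : Fin m → Sym2 (Fin n)),
        tutteZ ends q γ = 0 ∨
          (C : ℝ) ^ (-((n + m : ℕ) : ℤ)) ≤ ‖tutteZ ends q γ‖ := by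
  let K := IntermediateField.adjoin ℚ ({q, γ} : Set ℂ)
  have : FiniteDimensional ℚ K := by
    refine IntermediateField.finiteDimensional_adjoin fun x hx => ?_
    rcases hx with rfl | rfl
    · exact hq.isIntegral
    · exact hγ.isIntegral
  have : NumberField K := ⟨⟩
  exact core' (⟨q, IntermediateField.subset_adjoin _ _ (by simp)⟩ : K)
    (⟨γ, IntermediateField.subset_adjoin _ _ (by simp)⟩ : K) K.val
end

section
/- Let q and γ be complex numbers with q ≠ 0. Let a multigraph on Fin n with edges indexed by Fin (m+1) be given by ends : Fin (m+1) → Sym2 (Fin n), let s and t be two distinct vertices, and suppose the last edge joins s and t (ends of the edge with index m equal s(s, t)). Let G∖e denote the multigraph on Fin n consisting of the first m edges. Then Z_{st}(G; q, γ) = (1 + γ)·Z_{st}(G∖e; q, γ) + (γ/q)·Z_{s|t}(G∖e; q, γ), Z_{s|t}(G; q, γ) = Z_{s|t}(G∖e; q, γ), and consequently Z(G; q, γ) = (1 + γ)·Z_{st}(G∖e; q, γ) + (1 + γ/q)·Z_{s|t}(G∖e; q, γ). -/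
open scoped Classical

theorem reach_insert {n : ℕ} (E : Set (Sym2 (Fin n))) (s t : Fin n) (hst : s ≠ t) (u v : Fin n) :
    (SimpleGraph.fromEdgeSet (insert s(s,t) E)).Reachable u v ↔
      (SimpleGraph.fromEdgeSet E).Reachable u v ∨
      ((SimpleGraph.fromEdgeSet E).Reachable u s ∧ (SimpleGraph.fromEdgeSet E).Reachable t v) ∨
      ((SimpleGraph.fromEdgeSet E).Reachable u t ∧ (SimpleGraph.fromEdgeSet E).Reachable s v) := by
  have hle : SimpleGraph.fromEdgeSet E ≤ SimpleGraph.fromEdgeSet (insert s(s,t) E) :=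
    SimpleGraph.fromEdgeSet_mono (Set.subset_insert _ _)
  have hadj : (SimpleGraph.fromEdgeSet (insert s(s,t) E)).Reachable s t := by
    apply SimpleGraph.Adj.reachable
    simp [hst]
  constructor
  · rintro ⟨p⟩
    induction p with
    | nil => exact Or.inl (SimpleGraph.Reachable.refl _)
    | @cons a b c h p ih =>
      rw [SimpleGraph.fromEdgeSet_adj, Set.mem_insert_iff] at h
      obtain ⟨h1 | h1, h2⟩ := h
      · rw [Sym2.eq_iff] at h1
        rcases h1 with ⟨rfl, rfl⟩ | ⟨rfl, rfl⟩
        · rcases ih with ih | ⟨_, h⟩ | ⟨_, h⟩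
          · exact Or.inr (Or.inl ⟨.refl _, ih⟩)
          · exact Or.inr (Or.inl ⟨.refl _, h⟩)
          · exact Or.inl h
        · rcases ih with ih | ⟨_, h⟩ | ⟨_, h⟩
          · exact Or.inr (Or.inr ⟨.refl _, ih⟩)
          · exact Or.inl h
          · exact Or.inr (Or.inr ⟨.refl _, h⟩)
      · have hab : (SimpleGraph.fromEdgeSet E).Reachable a b := by
          apply SimpleGraph.Adj.reachable
          rw [SimpleGraph.fromEdgeSet_adj]
          exact ⟨h1, h2⟩
        rcases ih with ih | ⟨h, h'⟩ | ⟨h, h'⟩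
        · exact Or.inl (hab.trans ih)
        · exact Or.inr (Or.inl ⟨hab.trans h, h'⟩)
        · exact Or.inr (Or.inr ⟨hab.trans h, h'⟩)
  · rintro (h | ⟨h, h'⟩ | ⟨h, h'⟩)
    · exact h.mono hle
    · exact ((h.mono hle).trans hadj).trans (h'.mono hle)
    · exact ((h.mono hle).trans hadj.symm).trans (h'.mono hle)

theorem card_insert_reach {n : ℕ} (E : Set (Sym2 (Fin n))) (s t : Fin n) (hst : s ≠ t)
    (h : (SimpleGraph.fromEdgeSet E).Reachable s t) :
    Nat.card (SimpleGraph.fromEdgeSet (insert s(s,t) E)).ConnectedComponent =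
    Nat.card (SimpleGraph.fromEdgeSet E).ConnectedComponent := by
  have hle : SimpleGraph.fromEdgeSet E ≤ SimpleGraph.fromEdgeSet (insert s(s,t) E) :=
    SimpleGraph.fromEdgeSet_mono (Set.subset_insert _ _)
  symm
  refine Nat.card_eq_of_bijective (SimpleGraph.ConnectedComponent.map (SimpleGraph.Hom.ofLE hle))
    ⟨?_, SimpleGraph.ConnectedComponent.surjective_map_ofLE hle⟩
  intro a b
  induction a using SimpleGraph.ConnectedComponent.ind with | _ a
  induction b using SimpleGraph.ConnectedComponent.ind with | _ b
  intro hab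
  simp only [SimpleGraph.ConnectedComponent.map_mk, SimpleGraph.Hom.coe_ofLE, id,
    SimpleGraph.ConnectedComponent.eq] at hab ⊢
  rw [reach_insert E s t hst] at hab
  rcases hab with hab | ⟨h1, h2⟩ | ⟨h1, h2⟩
  · exact hab
  · exact (h1.trans h).trans h2
  · exact (h1.trans h.symm).trans h2

theorem card_insert_not_reach {n : ℕ} (E : Set (Sym2 (Fin n))) (s t : Fin n) (hst : s ≠ t)
    (h : ¬ (SimpleGraph.fromEdgeSet E).Reachable s t) :
    Nat.card (SimpleGraph.fromEdgeSet (insert s(s,t) E)).ConnectedComponent + 1 =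
    Nat.card (SimpleGraph.fromEdgeSet E).ConnectedComponent := by
  have hle : SimpleGraph.fromEdgeSet E ≤ SimpleGraph.fromEdgeSet (insert s(s,t) E) :=
    SimpleGraph.fromEdgeSet_mono (Set.subset_insert _ _)
  set T := (SimpleGraph.fromEdgeSet E).connectedComponentMk t with hT
  have h1 : Nat.card {c : (SimpleGraph.fromEdgeSet E).ConnectedComponent // c ≠ T} =
      Nat.card (SimpleGraph.fromEdgeSet (insert s(s,t) E)).ConnectedComponent := by
    refine Nat.card_eq_of_bijective
      (fun c => SimpleGraph.ConnectedComponent.map (SimpleGraph.Hom.ofLE hle) c.1) ⟨?_, ?_⟩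
    · rintro ⟨a, ha⟩ ⟨b, hb⟩
      induction a using SimpleGraph.ConnectedComponent.ind with | _ a
      induction b using SimpleGraph.ConnectedComponent.ind with | _ b
      intro hab
      simp only [SimpleGraph.ConnectedComponent.map_mk, SimpleGraph.Hom.coe_ofLE, id, hT, ne_eq,
        SimpleGraph.ConnectedComponent.eq, Subtype.mk.injEq] at hab ha hb ⊢
      rw [reach_insert E s t hst] at hab
      rcases hab with hab | ⟨h1, h2⟩ | ⟨h1, h2⟩
      · exact hab
      · exact absurd h2.symm hb
      · exact absurd h1 ha
    · intro b
      induction b using SimpleGraph.ConnectedComponent.ind with | _ b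
      by_cases hb : (SimpleGraph.fromEdgeSet E).Reachable b t
      · refine ⟨⟨(SimpleGraph.fromEdgeSet E).connectedComponentMk s, ?_⟩, ?_⟩
        · simpa [hT] using h
        · simp only [SimpleGraph.ConnectedComponent.map_mk, SimpleGraph.Hom.coe_ofLE, id,
            SimpleGraph.ConnectedComponent.eq]
          rw [reach_insert E s t hst]
          exact Or.inr (Or.inl ⟨.refl _, hb.symm⟩)
      · refine ⟨⟨(SimpleGraph.fromEdgeSet E).connectedComponentMk b, ?_⟩, ?_⟩
        · simpa [hT] using hb
        · simp
  have : Fintype (SimpleGraph.fromEdgeSet E).ConnectedComponent := Fintype.ofFinite _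
  have : Fintype {c : (SimpleGraph.fromEdgeSet E).ConnectedComponent // ¬ c = T} :=
    Fintype.ofFinite _
  simp only [ne_eq] at h1
  rw [← h1, Nat.card_eq_fintype_card, Nat.card_eq_fintype_card]
  rw [Fintype.card_subtype_compl, Fintype.card_subtype_eq]
  have : 0 < Fintype.card (SimpleGraph.fromEdgeSet E).ConnectedComponent :=
    Fintype.card_pos_iff.2 ⟨T⟩
  omega

theorem sum_finset_succ {m : ℕ} (f : Finset (Fin (m+1)) → ℂ) :
    ∑ A, f A = ∑ A : Finset (Fin m), f (A.map Fin.castSuccEmb) +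
      ∑ A : Finset (Fin m), f (insert (Fin.last m) (A.map Fin.castSuccEmb)) := by
  have hp : (Finset.univ.map (Fin.castSuccEmb (n := m))).powerset =
      (Finset.univ : Finset (Finset (Fin m))).map (Finset.mapEmbedding Fin.castSuccEmb).toEmbedding := by
    ext B
    simp only [Finset.mem_powerset, Finset.subset_map_iff, Finset.mem_map, Finset.mem_univ]
    simp [eq_comm]
  have hl : Fin.last m ∉ Finset.univ.map (Fin.castSuccEmb (n := m)) := by
    simp [Fin.castSucc_ne_last]
  rw [← Finset.powerset_univ, Fin.univ_castSuccEmb, Finset.cons_eq_insert,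
    Finset.sum_powerset_insert hl, hp, Finset.sum_map, Finset.sum_map]
  rfl

/-- The edge-addition/deletion identity (6.6): if the last edge of `G` joins
`s` and `t` and `G∖e` denotes the multigraph of the remaining edges, then
`Z_{st}(G) = (1+γ)Z_{st}(G∖e) + (γ/q)Z_{s|t}(G∖e)`,
`Z_{s|t}(G) = Z_{s|t}(G∖e)`, and
`Z(G) = (1+γ)Z_{st}(G∖e) + (1+γ/q)Z_{s|t}(G∖e)`. -/
theorem stmt_15 (q γ : ℂ) (hq : q ≠ 0)
    (n m : ℕ) (ends : Fin (m + 1) → Sym2 (Fin n)) (s t : Fin n) (hst : s ≠ t)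
    (hlast : ends (Fin.last m) = s(s, t))
    (ends' : Fin m → Sym2 (Fin n)) (hends' : ∀ j : Fin m, ends' j = ends j.castSucc) :
    tutteZst ends q γ s t =
      (1 + γ) * tutteZst ends' q γ s t + (γ / q) * tutteZsplit ends' q γ s t ∧
    tutteZsplit ends q γ s t = tutteZsplit ends' q γ s t ∧
    tutteZ ends q γ =
      (1 + γ) * tutteZst ends' q γ s t + (1 + γ / q) * tutteZsplit ends' q γ s t := by
  have e1 : ∀ A : Finset (Fin m), (A.map Fin.castSuccEmb).image ends = A.image ends' := by
    intro A
    rw [Finset.map_eq_image, Finset.image_image]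
    exact Finset.image_congr fun j _ => (hends' j).symm
  have e2 : ∀ A : Finset (Fin m), (((insert (Fin.last m) (A.map Fin.castSuccEmb)).image ends :
      Finset (Sym2 (Fin n))) : Set (Sym2 (Fin n))) = insert s(s,t) (A.image ends' : Finset _) := by
    intro A
    rw [Finset.image_insert, e1, hlast]
  have e3 : ∀ A : Finset (Fin m),
      (insert (Fin.last m) (A.map Fin.castSuccEmb)).card = A.card + 1 := by
    intro A
    rw [Finset.card_insert_of_notMem, Finset.card_map]
    simp [Fin.castSucc_ne_last]
  have hr : ∀ E : Set (Sym2 (Fin n)),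
      (SimpleGraph.fromEdgeSet (insert s(s,t) E)).Reachable s t := fun E =>
    (reach_insert E s t hst s t).2 (Or.inr (Or.inl ⟨.refl _, .refl _⟩))
  have k1 : tutteZst ends q γ s t =
      (1 + γ) * tutteZst ends' q γ s t + (γ / q) * tutteZsplit ends' q γ s t := by
    unfold tutteZsplit tutteZst tutteZ
    rw [sum_finset_succ]
    simp only [numComponents, e1, e2, e3, Finset.coe_insert, hr, if_true, Finset.card_map]
    rw [← Finset.sum_sub_distrib, Finset.mul_sum, Finset.mul_sum, ← Finset.sum_add_distrib,
      ← Finset.sum_add_distrib]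
    refine Finset.sum_congr rfl fun A _ => ?_
    split_ifs with h
    · rw [card_insert_reach _ s t hst h]; ring
    · rw [← card_insert_not_reach _ s t hst h]; field_simp; ring
  have k2 : tutteZsplit ends q γ s t = tutteZsplit ends' q γ s t := by
    unfold tutteZsplit tutteZst tutteZ
    rw [sum_finset_succ, sum_finset_succ]
    simp only [numComponents, e1, e2, e3, Finset.coe_insert, hr, if_true, Finset.card_map]
    ring
  refine ⟨k1, k2, ?_⟩
  have k3 : tutteZ ends q γ = tutteZsplit ends q γ s t + tutteZst ends q γ s t := by
    unfold tutteZsplit; ring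
  rw [k3, k1, k2]; ring
end
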